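/- Let M be an irreducible affine algebraic monoid with unit group G, let H ⊆ G be a closed subgroup, and let V be a finite-dimensional rational right H-module. Then there exist a finite-dimensional rational right M-module W, an extendible character χ ∈ E_M(H), and an injective morphism of right H-modules ι: V → (W|_H)_{χ^{-1}}. -/

import Mathlib

open MvPolynomial

namespace AlgebraicMonoid

variable (k : Type) [Field k] [IsAlgClosed k] (n : ℕ)

/-- `n × n` matrices over `k`: the ambient affine space for linear algebraic monoids. -/
abbrev Mat := Matrix (Fin n) (Fin n) k

/-- Polynomial functions on the space of `n × n` matrices. -/
abbrev MPoly := MvPolynomial (Fin n × Fin n) k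

variable {k n}

/-- Evaluation of a polynomial at a matrix. -/
noncomputable def mEval (x : Mat k n) (p : MPoly k n) : k :=
  eval (fun ij => x ij.1 ij.2) p

/-- The (regular function induced by) `p` vanishes identically on `X`. -/
def VanishesOn (X : Set (Mat k n)) (p : MPoly k n) : Prop :=
  ∀ x ∈ X, mEval x p = 0

/-- Zariski closed subsets of matrix space. -/
def ZClosed (X : Set (Mat k n)) : Prop :=
  ∃ S : Set (MPoly k n), X = {x | ∀ p ∈ S, mEval x p = 0}

/-- An affine (linear) algebraic monoid, realized as a Zariski closed submonoid of
matrix space (every affine algebraic monoid admits such a closed embedding). -/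
structure IsAlgMonoid (M : Set (Mat k n)) : Prop where
  zclosed : ZClosed M
  one_mem : (1 : Mat k n) ∈ M
  mul_mem : ∀ a ∈ M, ∀ b ∈ M, a * b ∈ M

/-- The unit group `G(M)` of the monoid `M`. -/
def unitGroup (M : Set (Mat k n)) : Set (Mat k n) :=
  {g | g ∈ M ∧ ∃ h ∈ M, g * h = 1 ∧ h * g = 1}

/-- `H` is an (abstract) subgroup of `G`. -/
def IsSubgroupOf (H G : Set (Mat k n)) : Prop :=
  H ⊆ G ∧ (1 : Mat k n) ∈ H ∧ (∀ a ∈ H, ∀ b ∈ H, a * b ∈ H) ∧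
    ∀ a ∈ H, ∃ b ∈ H, a * b = 1 ∧ b * a = 1

/-- `Y` is closed in `X` (for the Zariski topology). -/
def IsClosedIn (Y X : Set (Mat k n)) : Prop :=
  Y ⊆ X ∧ ∃ C : Set (Mat k n), ZClosed C ∧ Y = C ∩ X

/-- `X` is irreducible: nonempty, and its vanishing ideal is prime. -/
def IrreducibleSet (X : Set (Mat k n)) : Prop :=
  X.Nonempty ∧ ∀ p q : MPoly k n, VanishesOn X (p * q) → VanishesOn X p ∨ VanishesOn X q

/-- The action of `H` on `M` by left multiplication is observable: every nonzero
`H`-stable ideal of `k[M]` (presented as an ideal of the polynomial ring containing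
the vanishing ideal of `M`) contains a nonzero `H`-invariant function.
Here `H` acts on `k[M]` by `(f · h)(m) = f (h * m)`. -/
def LeftObservable (H M : Set (Mat k n)) : Prop :=
  ∀ J : Ideal (MPoly k n),
    (∀ p : MPoly k n, VanishesOn M p → p ∈ J) →
    (∀ p ∈ J, ∀ h ∈ H, ∃ p' ∈ J, ∀ m ∈ M, mEval m p' = mEval (h * m) p) →
    (∃ p ∈ J, ¬ VanishesOn M p) →
    ∃ p ∈ J, (¬ VanishesOn M p) ∧ ∀ h ∈ H, ∀ m ∈ M, mEval (h * m) p = mEval m p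

/-- `χ` defines a character of (the monoid) `X`, i.e. a regular multiplicative map to `k`. -/
structure IsCharacterOn (X : Set (Mat k n)) (χ : MPoly k n) : Prop where
  map_one : mEval 1 χ = 1
  map_mul : ∀ a ∈ X, ∀ b ∈ X, mEval (a * b) χ = mEval a χ * mEval b χ

/-- The character `χ` of `H` is extendible to `M`: there is a nonzero
`H`-semiinvariant `f ∈ k[M]` of weight `χ`, i.e. `f(h m) = χ(h) f(m)`. -/
def Extendible (M H : Set (Mat k n)) (χ : MPoly k n) : Prop :=
  ∃ f : MPoly k n, (¬ VanishesOn M f) ∧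
    ∀ h ∈ H, ∀ m ∈ M, mEval (h * m) f = mEval h χ * mEval m f

/-- The matrix of regular functions `P` evaluated at `x`: a rational representation. -/
noncomputable def repApply {d : ℕ} (P : Matrix (Fin d) (Fin d) (MPoly k n)) (x : Mat k n) :
    Matrix (Fin d) (Fin d) k :=
  Matrix.of fun i j => mEval x (P i j)

/-- `P` defines a (finite dimensional rational) right `M`-module structure on `k^d`,
the action being `v · x = v ᵥ* (P x)`. -/
def IsRightRep {d : ℕ} (M : Set (Mat k n)) (P : Matrix (Fin d) (Fin d) (MPoly k n)) : Prop :=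
  repApply P 1 = 1 ∧ ∀ a ∈ M, ∀ b ∈ M, repApply P (a * b) = repApply P a * repApply P b


section PolynomialRepresentations

variable {k : Type} [Field k] {n : ℕ}

@[simp] lemma mEval_zero (x : Mat k n) : mEval x 0 = 0 := map_zero _

@[simp] lemma mEval_one (x : Mat k n) : mEval x 1 = 1 := map_one _

@[simp] lemma mEval_C (x : Mat k n) (a : k) : mEval x (C a) = a := eval_C a

@[simp] lemma mEval_X (x : Mat k n) (ij : Fin n × Fin n) : mEval x (X ij) = x ij.1 ij.2 :=
  eval_X ij

@[simp] lemma mEval_add (x : Mat k n) (p q : MPoly k n) :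
    mEval x (p + q) = mEval x p + mEval x q := map_add _ p q

@[simp] lemma mEval_mul (x : Mat k n) (p q : MPoly k n) :
    mEval x (p * q) = mEval x p * mEval x q := map_mul _ p q

@[simp] lemma mEval_pow (x : Mat k n) (p : MPoly k n) (N : ℕ) :
    mEval x (p ^ N) = mEval x p ^ N := map_pow _ p N

@[simp] lemma mEval_prod (x : Mat k n) {ι : Type} (s : Finset ι) (f : ι → MPoly k n) :
    mEval x (∏ i ∈ s, f i) = ∏ i ∈ s, mEval x (f i) := map_prod _ f s

lemma mEval_det (x : Mat k n) {ι : Type} [Fintype ι] [DecidableEq ι]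
    (A : Matrix ι ι (MPoly k n)) : mEval x A.det = (A.map (mEval x)).det :=
  RingHom.map_det (eval fun ij : Fin n × Fin n => x ij.1 ij.2) A

lemma map_mEval_mul (x : Mat k n) {ι κ μ : Type} [Fintype κ]
    (A : Matrix ι κ (MPoly k n)) (B : Matrix κ μ (MPoly k n)) :
    (A * B).map (mEval x) = A.map (mEval x) * B.map (mEval x) :=
  Matrix.map_mul (f := eval fun ij : Fin n × Fin n => x ij.1 ij.2)

lemma map_mEval_C (x : Mat k n) {ι κ : Type} (A : Matrix ι κ k) :
    (A.map C).map (mEval x) = A := by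
  ext i j; simp

/-- `R` is a polynomial representation of the monoid of all `n × n` matrices. -/
structure IsPolyRep {L : Type} [Fintype L] [DecidableEq L]
    (R : Matrix L L (MPoly k n)) : Prop where
  map_one : R.map (mEval 1) = 1
  map_mul : ∀ x y : Mat k n, R.map (mEval (x * y)) = R.map (mEval x) * R.map (mEval y)

/-- A matrix-valued function of the form `x ↦ u * R x * v` for a polynomial representation
`R` and constant matrices `u`, `v`. -/
def IsMatrixCoeff {α β : Type} (B : Mat k n → Matrix α β k) : Prop :=
  ∃ (L : Type) (_ : Fintype L) (_ : DecidableEq L) (R : Matrix L L (MPoly k n)),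
    IsPolyRep R ∧ ∃ (u : Matrix α L k) (v : Matrix L β k),
      ∀ x, B x = u * R.map (mEval x) * v

namespace IsMatrixCoeff

variable {α β γ δ : Type}

lemma const (A : Matrix α β k) [Fintype α] [DecidableEq α] :
    IsMatrixCoeff fun _ : Mat k n => A := by
  refine ⟨α, inferInstance, inferInstance, 1, ⟨?_, fun x y => ?_⟩, 1, A, fun x => ?_⟩
  all_goals
    have h : ∀ x : Mat k n, (1 : Matrix α α (MPoly k n)).map (mEval x) = 1 := fun x =>
      Matrix.map_one _ (mEval_zero x) (mEval_one x)
    simp [h]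

lemma generic : IsMatrixCoeff fun x : Mat k n => x := by
  have h : ∀ x : Mat k n,
      (Matrix.of fun i j => (X (i, j) : MPoly k n)).map (mEval x) = x := fun x => by
    ext i j; simp
  refine ⟨Fin n, inferInstance, inferInstance, Matrix.of fun i j => X (i, j),
    ⟨h 1, fun x y => by simp only [h]⟩, 1, 1, fun x => by simp [h]⟩

lemma add {A B : Mat k n → Matrix α β k} (hA : IsMatrixCoeff A) (hB : IsMatrixCoeff B) :
    IsMatrixCoeff fun x => A x + B x := by
  obtain ⟨L, _, _, R, hR, u, v, h⟩ := hA
  obtain ⟨L', _, _, R', hR', u', v', h'⟩ := hB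
  have hmap : ∀ x : Mat k n, (Matrix.fromBlocks R 0 0 R').map (mEval x) =
      Matrix.fromBlocks (R.map (mEval x)) 0 0 (R'.map (mEval x)) := fun x => by
    rw [Matrix.fromBlocks_map]
    congr 1
  refine ⟨L ⊕ L', inferInstance, inferInstance, Matrix.fromBlocks R 0 0 R',
    ⟨?_, fun x y => ?_⟩, Matrix.fromCols u u', Matrix.fromRows v v', fun x => ?_⟩
  · rw [hmap, hR.map_one, hR'.map_one, Matrix.fromBlocks_one]
  · simp [hmap, hR.map_mul, hR'.map_mul, Matrix.fromBlocks_multiply]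
  · simp [hmap, h, h', Matrix.fromCols_mul_fromBlocks, Matrix.fromCols_mul_fromRows]

lemma mul_const {A : Mat k n → Matrix α β k} (hA : IsMatrixCoeff A) [Fintype β]
    (w : Matrix β γ k) : IsMatrixCoeff fun x => A x * w := by
  obtain ⟨L, _, _, R, hR, u, v, h⟩ := hA
  exact ⟨L, _, _, R, hR, u, v * w, fun x => by simp only [h, Matrix.mul_assoc]⟩

lemma const_mul {A : Mat k n → Matrix α β k} (hA : IsMatrixCoeff A) [Fintype α]
    (w : Matrix γ α k) : IsMatrixCoeff fun x => w * A x := by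
  obtain ⟨L, _, _, R, hR, u, v, h⟩ := hA
  exact ⟨L, _, _, R, hR, w * u, v, fun x => by simp only [h, Matrix.mul_assoc]⟩

lemma submatrix {A : Mat k n → Matrix α β k} (hA : IsMatrixCoeff A) (f : γ → α) (g : δ → β) :
    IsMatrixCoeff fun x => (A x).submatrix f g := by
  obtain ⟨L, _, _, R, hR, u, v, h⟩ := hA
  exact ⟨L, _, _, R, hR, u.submatrix f id, v.submatrix id g, fun x => by
    simp only [h]; rfl⟩

open scoped Kronecker in
lemma kronecker {A : Mat k n → Matrix α β k} {B : Mat k n → Matrix γ δ k}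
    (hA : IsMatrixCoeff A) (hB : IsMatrixCoeff B) :
    IsMatrixCoeff fun x => A x ⊗ₖ B x := by
  obtain ⟨L, _, _, R, hR, u, v, h⟩ := hA
  obtain ⟨L', _, _, R', hR', u', v', h'⟩ := hB
  have hmap : ∀ x : Mat k n, (R ⊗ₖ R').map (mEval x) =
      R.map (mEval x) ⊗ₖ R'.map (mEval x) := fun x => by
    ext i j; simp
  refine ⟨L × L', inferInstance, inferInstance, R ⊗ₖ R', ⟨?_, fun x y => ?_⟩,
    u ⊗ₖ u', v ⊗ₖ v', fun x => ?_⟩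
  · rw [hmap, hR.map_one, hR'.map_one, Matrix.one_kronecker_one]
  · simp only [hmap, hR.map_mul, hR'.map_mul, Matrix.mul_kronecker_mul]
  · simp only [hmap, h, h', Matrix.mul_kronecker_mul]

lemma sum {ι : Type} (s : Finset ι) [Fintype α] [DecidableEq α]
    {A : ι → Mat k n → Matrix α β k} (hA : ∀ i, IsMatrixCoeff (A i)) :
    IsMatrixCoeff fun x => ∑ i ∈ s, A i x := by
  classical
  induction s using Finset.induction_on with
  | empty => simpa using const (n := n) (0 : Matrix α β k)
  | insert a s ha ih =>
    simp only [Finset.sum_insert ha]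
    exact (hA a).add ih

/-- Every polynomial function on matrix space is a matrix coefficient. -/
lemma of_polynomial (p : MPoly k n) :
    IsMatrixCoeff fun x : Mat k n => (Matrix.of fun _ _ => mEval x p : Matrix Unit Unit k) := by
  induction p using MvPolynomial.induction_on with
  | C a => simpa using const (n := n) (Matrix.of fun _ _ => a : Matrix Unit Unit k)
  | add p q hp hq =>
    convert hp.add hq using 2 with x
    ext; simp
  | mul_X p ij hp =>
    convert (hp.kronecker (generic.submatrix (fun _ : Unit => ij.1)
      (fun _ : Unit => ij.2))).submatrix (fun _ : Unit => ((), ())) (fun _ : Unit => ((), ()))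
      using 2 with x
    ext; simp

/-- Every matrix of polynomial functions on matrix space is a matrix coefficient. -/
lemma of_polynomialMatrix [Fintype α] [Fintype β] [DecidableEq α] [DecidableEq β]
    (B : Matrix α β (MPoly k n)) : IsMatrixCoeff fun x => B.map (mEval x) := by
  have h := sum Finset.univ fun ab : α × β =>
    ((of_polynomial (B ab.1 ab.2)).mul_const
      (Matrix.of fun _ j => if j = ab.2 then 1 else 0 : Matrix Unit β k)).const_mul
      (Matrix.of fun i _ => if i = ab.1 then 1 else 0 : Matrix α Unit k)
  convert h using 2 with x
  ext i j
  simp [Matrix.sum_apply, Matrix.mul_apply, Fintype.sum_prod_type]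

end IsMatrixCoeff

end PolynomialRepresentations

section LinearAlgebra

variable {k : Type} [Field k]

/-- A subspace `K` of `k^L` is the row space of a matrix with a right inverse. -/
lemma exists_rowBasis {L : Type} [Fintype L] [DecidableEq L] (K : Submodule k (L → k)) :
    ∃ (r : ℕ) (A : Matrix (Fin r) L k) (B : Matrix L (Fin r) k),
      A * B = 1 ∧ (∀ i, A i ∈ K) ∧
      ∀ w ∈ K, Matrix.vecMul (Matrix.vecMul w B) A = w := by
  obtain ⟨π, hπ⟩ := K.subtype.exists_leftInverse_of_injective K.ker_subtype
  let b := Module.finBasis k K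
  let B : Matrix L (Fin (Module.finrank k K)) k :=
    LinearMap.toMatrix' (b.equivFun.toLinearMap ∘ₗ π) |>.transpose
  have hB : ∀ w : K, Matrix.vecMul (w : L → k) B = b.equivFun w := fun w => by
    rw [Matrix.vecMul_transpose, LinearMap.toMatrix'_mulVec]
    have := LinearMap.congr_fun hπ w
    simpa using congrArg b.equivFun this
  refine ⟨_, Matrix.of fun i => (b i : L → k), B, ?_, fun i => (b i).2, fun w hw => ?_⟩
  · ext i j
    have h := congrFun (hB (b i)) j
    rw [Matrix.mul_apply_eq_vecMul]
    refine h.trans ?_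
    simp [Matrix.one_apply]
  · rw [hB ⟨w, hw⟩]
    have h := congrArg Subtype.val (b.sum_equivFun ⟨w, hw⟩)
    rw [AddSubmonoidClass.coe_finsetSum] at h
    rw [Matrix.vecMul_eq_sum]
    exact h

/-- Expansion of the determinant of a product of rectangular matrices. -/
lemma det_mul_eq_sum_minors {ρ L : Type} [Fintype ρ] [DecidableEq ρ] [Fintype L]
    (A : Matrix ρ L k) (B : Matrix L ρ k) :
    (A * B).det = ∑ I : ρ → L, (A.submatrix id I).det * ∏ i, B (I i) i := by
  classical
  simp only [Matrix.det_apply', Matrix.mul_apply, Finset.prod_univ_sum, Fintype.piFinset_univ,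
    Finset.mul_sum, Finset.sum_mul, Matrix.submatrix_apply, id]
  rw [Finset.sum_comm]
  refine Finset.sum_congr rfl fun I _ => Finset.sum_congr rfl fun σ _ => ?_
  rw [Finset.prod_mul_distrib, mul_assoc]

lemma fromRows_submatrix_eq_updateRow {L : Type} {r : ℕ} (A : Matrix (Fin r) L k) (w : L → k)
    (J : Unit ⊕ Fin r → L) : (Matrix.fromRows (Matrix.of fun _ : Unit => w) A).submatrix id J =
      ((Matrix.fromRows (Matrix.of fun _ : Unit => 0) A).submatrix id J).updateRow
        (Sum.inl ()) (w ∘ J) := by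
  ext i j
  rcases i with i | i <;> simp [Matrix.updateRow_apply]

/-- The maximal minors of the matrix with rows `w` and the rows of `A`,
as a linear function of `w`. -/
def minorsMap {L : Type} {r : ℕ} (A : Matrix (Fin r) L k) :
    (L → k) →ₗ[k] ((Unit ⊕ Fin r → L) → k) where
  toFun w J := ((Matrix.fromRows (Matrix.of fun _ : Unit => w) A).submatrix id J).det
  map_add' w w' := by
    ext J
    simp only [fromRows_submatrix_eq_updateRow A (w + w'), fromRows_submatrix_eq_updateRow A w,
      fromRows_submatrix_eq_updateRow A w', Pi.add_apply]
    exact Matrix.det_updateRow_add _ _ (w ∘ J) (w' ∘ J)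
  map_smul' a w := by
    ext J
    rw [Pi.smul_apply, fromRows_submatrix_eq_updateRow A (a • w),
      fromRows_submatrix_eq_updateRow A w]
    exact Matrix.det_updateRow_smul _ _ a (w ∘ J)

lemma minorsMap_apply {L : Type} {r : ℕ} (A : Matrix (Fin r) L k) (w : L → k)
    (J : Unit ⊕ Fin r → L) : minorsMap A w J =
      ((Matrix.fromRows (Matrix.of fun _ : Unit => w) A).submatrix id J).det := rfl

end LinearAlgebra

section TensorPower

variable {k : Type} [Field k] {n : ℕ}

/-- The tensor power, indexed by `ρ`, of a polynomial representation. -/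
noncomputable def tensorPower {L : Type} (ρ : Type) [Fintype ρ] (R : Matrix L L (MPoly k n)) :
    Matrix (ρ → L) (ρ → L) (MPoly k n) :=
  Matrix.of fun I J => ∏ i, R (I i) (J i)

lemma IsPolyRep.tensorPower {L ρ : Type} [Fintype L] [DecidableEq L] [Fintype ρ]
    [DecidableEq ρ] {R : Matrix L L (MPoly k n)} (hR : IsPolyRep R) :
    IsPolyRep (tensorPower ρ R) := by
  have hmap : ∀ x I J, (AlgebraicMonoid.tensorPower ρ R).map (mEval x) I J =
      ∏ i, R.map (mEval x) (I i) (J i) := fun x I J => by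
    simp [AlgebraicMonoid.tensorPower]
  refine ⟨?_, fun x y => ?_⟩
  · ext I J
    rw [hmap, hR.map_one]
    simp only [Matrix.one_apply, Finset.prod_ite_zero, Finset.prod_const_one, funext_iff,
      Finset.mem_univ, true_implies]
  · ext I J
    rw [hmap, hR.map_mul]
    simp only [Matrix.mul_apply, hmap, Finset.prod_univ_sum, Fintype.piFinset_univ,
      Finset.prod_mul_distrib]

lemma minorsMap_vecMul_tensorPower {L : Type} [Fintype L] {r : ℕ} (A : Matrix (Fin r) L k)
    (w : L → k) (R : Matrix L L (MPoly k n)) (x : Mat k n) (J : Unit ⊕ Fin r → L) :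
    Matrix.vecMul (minorsMap A w) ((tensorPower (Unit ⊕ Fin r) R).map (mEval x)) J =
      ((Matrix.fromRows (Matrix.of fun _ : Unit => w) A * R.map (mEval x)).submatrix id J).det := by
  have h : (Matrix.fromRows (Matrix.of fun _ : Unit => w) A * R.map (mEval x)).submatrix id J =
      Matrix.fromRows (Matrix.of fun _ : Unit => w) A * (R.map (mEval x)).submatrix id J := rfl
  rw [h, det_mul_eq_sum_minors]
  simp [Matrix.vecMul, dotProduct, tensorPower, minorsMap_apply]

end TensorPower

section UnitGroup

variable {k : Type} [Field k] {n : ℕ}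

/-- The left annihilator, for a polynomial representation `R`, of the column space of
`R x * v` for `x ∈ Y`. -/
def coeffAnnihilator {L β : Type} [Fintype L] (R : Matrix L L (MPoly k n)) (v : Matrix L β k)
    (Y : Set (Mat k n)) : Submodule k (L → k) where
  carrier := {w | ∀ x ∈ Y, Matrix.vecMul w (R.map (mEval x) * v) = 0}
  add_mem' ha hb x hx := by rw [Matrix.add_vecMul, ha x hx, hb x hx, add_zero]
  zero_mem' x _ := Matrix.zero_vecMul _
  smul_mem' a w hw x hx := by rw [Matrix.smul_vecMul, hw x hx, smul_zero]

lemma vecMul_mem_coeffAnnihilator {L β : Type} [Fintype L] [DecidableEq L]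
    {R : Matrix L L (MPoly k n)} (hR : IsPolyRep R) {v : Matrix L β k} {Y : Set (Mat k n)}
    {h : Mat k n} (hY : ∀ y ∈ Y, h * y ∈ Y) {w : L → k} (hw : w ∈ coeffAnnihilator R v Y) :
    Matrix.vecMul w (R.map (mEval h)) ∈ coeffAnnihilator R v Y := fun y hy => by
  have := hw _ (hY y hy)
  rwa [hR.map_mul, Matrix.mul_assoc, ← Matrix.vecMul_vecMul] at this

/-- A closed submonoid of matrix space contains the inverses of its invertible elements. -/
lemma IsAlgMonoid.mem_of_mul_eq_one {M : Set (Mat k n)} (hM : IsAlgMonoid M) {x y : Mat k n}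
    (hx : x ∈ M) (hxy : x * y = 1) : y ∈ M := by
  obtain ⟨S, hS⟩ := hM.zclosed
  rw [hS]
  intro p hp
  obtain ⟨L, _, _, R, hR, u, v, h⟩ := IsMatrixCoeff.of_polynomial p
  let K := coeffAnnihilator R v M
  have hinv : R.map (mEval x) * R.map (mEval y) = 1 := by rw [← hR.map_mul, hxy, hR.map_one]
  let T : K →ₗ[k] K := (Matrix.vecMulLinear (R.map (mEval x))).restrict fun w hw =>
    vecMul_mem_coeffAnnihilator hR (hM.mul_mem x hx) hw
  have hT : Function.Injective T := fun a b hab => by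
    have h1 : Matrix.vecMul (a : L → k) (R.map (mEval x)) =
      Matrix.vecMul (b : L → k) (R.map (mEval x)) := congrArg Subtype.val hab
    have h2 := congrArg (fun w => Matrix.vecMul w (R.map (mEval y))) h1
    simp only [Matrix.vecMul_vecMul, hinv, Matrix.vecMul_one] at h2
    exact Subtype.ext h2
  have hu : u () ∈ K := fun m hm => by
    have hpm : mEval m p = 0 := by
      rw [hS] at hm
      exact hm p hp
    ext j
    have h1 := congrFun (congrFun (h m) ()) j
    rw [Matrix.mul_assoc, Matrix.mul_apply_eq_vecMul] at h1
    exact h1.symm.trans hpm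
  obtain ⟨w, hw⟩ := LinearMap.injective_iff_surjective.mp hT ⟨u (), hu⟩
  have hw' : Matrix.vecMul (w : L → k) (R.map (mEval x)) = u () := congrArg Subtype.val hw
  have h1 := congrFun (congrFun (h y) ()) ()
  rw [Matrix.mul_assoc, Matrix.mul_apply_eq_vecMul, ← hw', Matrix.vecMul_vecMul,
    ← Matrix.mul_assoc, hinv] at h1
  have h2 := congrFun (w.2 1 hM.one_mem) ()
  rw [hR.map_one] at h2
  exact h1.trans h2

lemma IsAlgMonoid.mem_unitGroup {M : Set (Mat k n)} (hM : IsAlgMonoid M) {x : Mat k n}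
    (hx : x ∈ M) (hdet : x.det ≠ 0) : x ∈ unitGroup M := by
  have hu : IsUnit x.det := isUnit_iff_ne_zero.mpr hdet
  exact ⟨hx, x⁻¹, hM.mem_of_mul_eq_one hx (Matrix.mul_nonsing_inv x hu),
    Matrix.mul_nonsing_inv x hu, Matrix.nonsing_inv_mul x hu⟩

variable (k n) in
/-- The determinant as a polynomial function on matrix space. -/
noncomputable def detPoly : MPoly k n := (Matrix.of fun i j => X (i, j)).det

@[simp] lemma mEval_detPoly (x : Mat k n) : mEval x (detPoly k n) = x.det := by
  rw [detPoly, mEval_det]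
  congr 1
  ext i j; simp

/-- On a closed subset of the unit group, the inverse of a nowhere vanishing polynomial is a
polynomial divided by a power of the determinant. -/
lemma exists_mul_eq_det_pow [IsAlgClosed k] {M H : Set (Mat k n)} (hM : IsAlgMonoid M)
    (hHcl : IsClosedIn H (unitGroup M)) {s : MPoly k n} (hs : ∀ h ∈ H, mEval h s ≠ 0) :
    ∃ (N : ℕ) (p : MPoly k n), ∀ h ∈ H, mEval h p * mEval h s = h.det ^ N := by
  obtain ⟨-, Z, ⟨S, rfl⟩, hH⟩ := hHcl
  obtain ⟨S', hS'⟩ := hM.zclosed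
  have hdet : detPoly k n ∈ (Ideal.span (S ∪ S') ⊔ Ideal.span {s}).radical := by
    rw [← MvPolynomial.vanishingIdeal_zeroLocus_eq_radical (K := k),
      MvPolynomial.mem_vanishingIdeal_iff]
    intro z hz
    rw [MvPolynomial.mem_zeroLocus_iff] at hz
    let x : Mat k n := Matrix.of fun i j => z (i, j)
    have hx : ∀ p : MPoly k n, mEval x p = aeval z p := fun p => by
      rw [MvPolynomial.aeval_eq_eval]; rfl
    have hz' : ∀ p ∈ S ∪ S', mEval x p = 0 := fun p hp =>
      (hx p).trans (hz p (Ideal.mem_sup_left (Ideal.subset_span hp)))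
    have hzs : mEval x s = 0 :=
      (hx s).trans (hz s (Ideal.mem_sup_right (Ideal.mem_span_singleton_self s)))
    rw [← hx, mEval_detPoly]
    by_contra hne
    have hxM : x ∈ M := by
      rw [hS']
      exact fun p hp => hz' p (Or.inr hp)
    refine hs x ?_ hzs
    rw [hH]
    exact ⟨fun p hp => hz' p (Or.inl hp), hM.mem_unitGroup hxM hne⟩
  obtain ⟨N, hN⟩ := hdet
  obtain ⟨a, ha, b, hb, hab⟩ := Submodule.mem_sup.mp hN
  obtain ⟨p, rfl⟩ := Ideal.mem_span_singleton'.mp hb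
  refine ⟨N, p, fun h hh => ?_⟩
  rw [hH] at hh
  have hS : ∀ q ∈ S ∪ S', mEval h q = 0 := by
    rintro q (hq | hq)
    · exact hh.1 q hq
    · have := hh.2.1
      rw [hS'] at this
      exact this q hq
  have ha0 : mEval h a = 0 := by
    have hle : Ideal.span (S ∪ S') ≤
        RingHom.ker (eval fun ij : Fin n × Fin n => h ij.1 ij.2) :=
      Ideal.span_le.mpr hS
    exact hle ha
  have := congrArg (mEval h) hab
  simpa [ha0] using this

end UnitGroup

/-- Let `M` be an irreducible affine algebraic monoid with unit group
`G`, let `H ⊆ G` be a closed subgroup, and let `V` be a finite dimensional rational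
right `H`-module.  Then there exist a finite dimensional rational right `M`-module `W`,
an extendible character `χ ∈ E_M(H)` and an injective morphism of right `H`-modules
`ι : V → (W|_H)_{χ⁻¹}`.

Since `H` is only assumed closed in `G` (which is open in `M`), regular functions on
`H` are quotients of polynomials; a rational right `H`-module of dimension `e` is
therefore presented as `A(h) = s(h)⁻¹ • Q(h)` with `Q` a matrix of polynomials and `s`
a polynomial nonvanishing on `H`, and a character of `H` as a quotient `c/t`. -/
theorem embed_module_into_twisted_restriction
    {k : Type} [Field k] [IsAlgClosed k] {n e : ℕ}
    (M H : Set (Mat k n)) (hM : IsAlgMonoid M) (hMirr : IrreducibleSet M)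
    (hH : IsSubgroupOf H (unitGroup M)) (hHcl : IsClosedIn H (unitGroup M))
    -- the rational right `H`-module `V = k^e`, with action `v · h = v ᵥ* (s(h)⁻¹ • Q(h))`
    (Q : Matrix (Fin e) (Fin e) (MPoly k n)) (s : MPoly k n)
    (hs : ∀ h ∈ H, mEval h s ≠ 0)
    (hQone : (mEval (1 : Mat k n) s)⁻¹ • repApply Q (1 : Mat k n) = 1)
    (hQmul : ∀ a ∈ H, ∀ b ∈ H,
      (mEval (a * b) s)⁻¹ • repApply Q (a * b) =
        ((mEval a s)⁻¹ • repApply Q a) * ((mEval b s)⁻¹ • repApply Q b)) :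
    ∃ (d : ℕ) (P : Matrix (Fin d) (Fin d) (MPoly k n)),
      IsRightRep M P ∧
      ∃ c t : MPoly k n,
        -- `χ = c/t` is a character of `H` …
        (∀ h ∈ H, mEval h t ≠ 0) ∧ (∀ h ∈ H, mEval h c ≠ 0) ∧
        mEval (1 : Mat k n) c = mEval (1 : Mat k n) t ∧
        (∀ a ∈ H, ∀ b ∈ H,
          mEval (a * b) c * (mEval a t * mEval b t) =
            (mEval a c * mEval b c) * mEval (a * b) t) ∧
        -- … which is extendible to `M`: some nonzero `F ∈ k[M]` satisfies `F(hm) = χ(h) F(m)` …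
        (∃ F : MPoly k n, (¬ VanishesOn M F) ∧
          ∀ h ∈ H, ∀ m ∈ M,
            mEval h t * mEval (h * m) F = mEval h c * mEval m F) ∧
        -- … and `ι` is an injective morphism of right `H`-modules `V → (W|_H)_{χ⁻¹}`
        ∃ ι : (Fin e → k) →ₗ[k] (Fin d → k), Function.Injective ι ∧
          ∀ h ∈ H, ∀ v : Fin e → k,
            ι (Matrix.vecMul v ((mEval h s)⁻¹ • repApply Q h)) =
              (mEval h c / mEval h t)⁻¹ • Matrix.vecMul (ι v) (repApply P h) := by
  obtain ⟨N, p, hp⟩ := exists_mul_eq_det_pow hM hHcl hs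
  obtain ⟨-, hH1, hHmul, hHinv⟩ := hH
  obtain ⟨A, hA⟩ : ∃ A : Mat k n → Matrix (Fin e) (Fin e) k,
      ∀ h, (mEval h s)⁻¹ • repApply Q h = A h := ⟨_, fun _ => rfl⟩
  simp only [hA] at hQone hQmul ⊢
  obtain ⟨L, _, _, R, hR, u, v, huv⟩ := IsMatrixCoeff.of_polynomialMatrix (p • Q)
  have hB : ∀ h ∈ H, u * R.map (mEval h) * v = h.det ^ N • A h := fun h hh => by
    rw [← huv, ← hp h hh]
    ext i j
    simp [← hA, repApply, mul_assoc, mul_inv_cancel_left₀ (hs h hh)]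
  have huv1 : u * v = 1 := by
    have h := hB 1 hH1
    rw [hR.map_one, Matrix.mul_one] at h
    rw [h, hQone, Matrix.det_one, one_pow, one_smul]
  set K := coeffAnnihilator R v H
  obtain ⟨r, E, E', hEE', hEK, hKE⟩ := exists_rowBasis K
  have hK : ∀ w ∈ K, ∀ h ∈ H, Matrix.vecMul w (R.map (mEval h)) ∈ K := fun w hw h hh =>
    vecMul_mem_coeffAnnihilator hR (hHmul h hh) hw
  have hEv : E * v = 0 := by
    ext i j
    have h := congrFun (hEK i 1 hH1) j
    rwa [hR.map_one, Matrix.one_mul] at h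
  let D : Mat k n → Matrix (Fin r) (Fin r) k := fun x => E * R.map (mEval x) * E'
  have hD : ∀ h ∈ H, E * R.map (mEval h) = D h * E := fun h hh => by
    ext i j
    have h1 := congrFun (hKE _ (hK _ (hEK i) h hh)) j
    simp only [D, Matrix.mul_apply_eq_vecMul]
    exact h1.symm
  let D' : Matrix (Fin r) (Fin r) (MPoly k n) := (E.map C : Matrix _ _ (MPoly k n)) * R *
    (E'.map C : Matrix _ _ (MPoly k n))
  let c : MPoly k n := detPoly k n ^ N * D'.det
  have hc : ∀ x, mEval x c = x.det ^ N * (D x).det := fun x => by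
    simp only [c, D, D', mEval_mul, mEval_pow, mEval_detPoly, mEval_det, map_mEval_mul, map_mEval_C]
  have hc1 : mEval 1 c = 1 := by
    rw [hc]
    simp [D, hR.map_one, hEE']
  have hcmul : ∀ h ∈ H, ∀ x, mEval (h * x) c = mEval h c * mEval x c := fun h hh x => by
    have h1 : D (h * x) = D h * D x := by
      simp only [D, hR.map_mul]
      rw [← Matrix.mul_assoc E, hD h hh, Matrix.mul_assoc (D h) E, Matrix.mul_assoc (D h),
        Matrix.mul_assoc E, Matrix.mul_assoc (D h) E E', hEE', Matrix.mul_one]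
    rw [hc, hc, hc, h1, Matrix.det_mul, Matrix.det_mul]
    ring
  have hc0 : ∀ h ∈ H, mEval h c ≠ 0 := fun h hh => by
    obtain ⟨y, -, hy, -⟩ := hHinv h hh
    exact left_ne_zero_of_mul_eq_one (by rw [← hcmul h hh, hy, hc1])
  let φ := Fintype.equivFin (Unit ⊕ Fin r → L)
  have hT := hR.tensorPower (ρ := Unit ⊕ Fin r)
  let P := (tensorPower (Unit ⊕ Fin r) R).submatrix φ.symm φ.symm
  have hP : ∀ x, repApply P x =
      ((tensorPower (Unit ⊕ Fin r) R).map (mEval x)).submatrix φ.symm φ.symm := fun x => rfl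
  let ι : (Fin e → k) →ₗ[k] (Fin (Fintype.card (Unit ⊕ Fin r → L)) → k) :=
    (LinearEquiv.funCongrLeft k k φ.symm).toLinearMap ∘ₗ minorsMap E ∘ₗ Matrix.vecMulLinear u
  refine ⟨_, P, ⟨?_, fun a _ b _ => ?_⟩, c, 1, fun h _ => by simp, hc0, by simp [hc1],
    fun a ha b _ => by simp [hcmul a ha], ⟨c, fun h0 => ?_, fun h hh m _ => by simp [hcmul h hh]⟩,
    ι, ?_, fun h hh w => ?_⟩
  · rw [hP, hT.map_one, Matrix.submatrix_one_equiv]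
  · rw [hP, hP, hP, hT.map_mul, Matrix.submatrix_mul_equiv]
  · exact one_ne_zero (hc1.symm.trans (h0 1 hM.one_mem))
  · rw [injective_iff_map_eq_zero]
    intro w hw
    have hmin : minorsMap E (Matrix.vecMul w u) = 0 :=
      (LinearEquiv.map_eq_zero_iff (LinearEquiv.funCongrLeft k k φ.symm)).mp hw
    ext b
    have hmul : Matrix.fromRows (Matrix.of fun _ : Unit => Matrix.vecMul w u) E *
        Matrix.fromCols (Matrix.of fun l (_ : Unit) => v l b) E' =
        Matrix.fromBlocks (Matrix.of fun _ _ => w b)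
          ((Matrix.of fun _ : Unit => Matrix.vecMul w u) * E') 0 1 := by
      rw [Matrix.fromRows_mul_fromCols, hEE']
      congr 1
      · ext i j
        have h := congrFun (Matrix.vecMul_vecMul w u v) b
        rw [huv1, Matrix.vecMul_one] at h
        exact h
      · ext i j
        exact congrFun (congrFun hEv i) b
    have hdet := congrArg Matrix.det hmul
    rw [det_mul_eq_sum_minors, Matrix.det_fromBlocks_zero₂₁] at hdet
    simp only [← minorsMap_apply, hmin] at hdet
    simpa using hdet.symm
  · have hrow : Matrix.vecMul (Matrix.vecMul w u) (R.map (mEval h)) -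
        h.det ^ N • Matrix.vecMul (Matrix.vecMul w (A h)) u ∈ K := fun y hy => by
      have hAy : A (h * y) = A h * A y := hQmul h hh y hy
      have h1 : u * (R.map (mEval h) * (R.map (mEval y) * v)) =
          h.det ^ N • (A h * (u * (R.map (mEval y) * v))) := by
        rw [← Matrix.mul_assoc u (R.map (mEval y)), hB y hy, ← Matrix.mul_assoc (R.map (mEval h)),
          ← hR.map_mul, ← Matrix.mul_assoc, hB _ (hHmul h hh y hy), hAy, Matrix.det_mul, mul_pow,
          Matrix.mul_smul, smul_smul]
      rw [Matrix.sub_vecMul, Matrix.smul_vecMul]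
      simp only [Matrix.vecMul_vecMul]
      rw [Matrix.mul_assoc, Matrix.mul_assoc, h1, Matrix.vecMul_smul, sub_self]
    set z := Matrix.vecMul (Matrix.vecMul w u) (R.map (mEval h)) -
      h.det ^ N • Matrix.vecMul (Matrix.vecMul w (A h)) u with hz
    let T : Matrix (Unit ⊕ Fin r) (Unit ⊕ Fin r) k :=
      Matrix.fromBlocks (Matrix.of fun _ _ => h.det ^ N)
        (Matrix.of fun _ => Matrix.vecMul z E') 0 (D h)
    have hmul : Matrix.fromRows (Matrix.of fun _ : Unit => Matrix.vecMul w u) E *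
        R.map (mEval h) = T *
        Matrix.fromRows (Matrix.of fun _ : Unit => Matrix.vecMul (Matrix.vecMul w (A h)) u) E := by
      simp only [T]
      rw [Matrix.fromRows_mul, Matrix.fromBlocks_mul_fromRows, hD h hh, Matrix.zero_mul, zero_add]
      congr 1
      ext i j
      have h1 := congrFun (hKE z hrow) j
      have h2 := congrFun hz j
      rw [Matrix.add_apply, Matrix.mul_apply_eq_vecMul, Matrix.mul_apply_eq_vecMul,
        Matrix.mul_apply_eq_vecMul]
      have h3 : Matrix.vecMul (Matrix.of (fun _ _ => h.det ^ N : Unit → Unit → k) i)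
          (Matrix.of fun _ : Unit => Matrix.vecMul (Matrix.vecMul w (A h)) u) j =
          h.det ^ N * Matrix.vecMul (Matrix.vecMul w (A h)) u j :=
        Fintype.sum_unique fun _ : Unit =>
          h.det ^ N * Matrix.vecMul (Matrix.vecMul w (A h)) u j
      refine Eq.trans ?_ (congrArg₂ (· + ·) h3.symm h1.symm)
      rw [h2, Pi.sub_apply, Pi.smul_apply, smul_eq_mul, add_sub_cancel]
      rfl
    have hmin : Matrix.vecMul (minorsMap E (Matrix.vecMul w u))
        ((tensorPower (Unit ⊕ Fin r) R).map (mEval h)) =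
        mEval h c • minorsMap E (Matrix.vecMul (Matrix.vecMul w (A h)) u) := by
      ext J
      rw [minorsMap_vecMul_tensorPower, hmul, hc, Pi.smul_apply, minorsMap_apply, smul_eq_mul]
      have h1 : ∀ F : Matrix (Unit ⊕ Fin r) L k,
          (T * F).submatrix id J = T * F.submatrix id J := fun _ => rfl
      rw [h1, Matrix.det_mul, Matrix.det_fromBlocks_zero₂₁]
      simp
    have hι : Matrix.vecMul (ι w) (repApply P h) = mEval h c • ι (Matrix.vecMul w (A h)) := by
      rw [hP]
      have h1 := congrArg (· ∘ φ.symm) hmin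
      refine Eq.trans ?_ h1
      ext J
      exact Fintype.sum_equiv φ.symm _ _ fun _ => rfl
    rw [hι, mEval_one, div_one, smul_smul, inv_mul_cancel₀ (hc0 h hh), one_smul]

end AlgebraicMonoid
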